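/- There exist an absolute constant C>0 and n₀ such that the following holds for all n ≥ n₀. Let a₁,…,a_n ∈ ℝ and X = Σ_{i=1}^n a_i ξ_i, where ξ is uniformly distributed on the set of binary vectors in {0,1}^n with exactly s ones, and suppose min(s, n−s) ≥ n(log n)^{−2}. Suppose further that |a_i| ≤ n^{−1/2}(log n)² for all i, and that η² = Σ_{i=1}^n a_i² − (Σ_{i=1}^n a_i)²/n ≤ √(log n). Then |log E[e^X] − E[X] − Var[X]/2| ≤ C n^{−1/9}. -/

import Mathlib

open Finset

open scoped Classical

/-- The expectation of `f` with respect to the uniform measure on the "slice" of the Boolean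
hypercube `{0,1}^n` consisting of vectors with exactly `s` ones (identified with the
`s`-element subsets of `Fin n`). -/
noncomputable def sliceExp (n s : ℕ) (f : Finset (Fin n) → ℝ) : ℝ :=
  (∑ T ∈ Finset.powersetCard s (univ : Finset (Fin n)), f T) /
    ((Finset.powersetCard s (univ : Finset (Fin n))).card : ℝ)

theorem sliceExp_add {n s : ℕ} (f g : Finset (Fin n) → ℝ) :
    sliceExp n s (fun T => f T + g T) = sliceExp n s f + sliceExp n s g := by
  simp only [sliceExp, sum_add_distrib, add_div]

theorem sliceExp_sub {n s : ℕ} (f g : Finset (Fin n) → ℝ) :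
    sliceExp n s (fun T => f T - g T) = sliceExp n s f - sliceExp n s g := by
  simp only [sliceExp, sum_sub_distrib, sub_div]

theorem sliceExp_const_mul {n s : ℕ} (c : ℝ) (f : Finset (Fin n) → ℝ) :
    sliceExp n s (fun T => c * f T) = c * sliceExp n s f := by
  simp only [sliceExp, ← mul_sum, mul_div_assoc]

theorem sliceExp_sum {n s : ℕ} {ι : Type*} (I : Finset ι) (f : ι → Finset (Fin n) → ℝ) :
    sliceExp n s (fun T => ∑ i ∈ I, f i T) = ∑ i ∈ I, sliceExp n s (f i) := by
  simp only [sliceExp, sum_comm (t := I), sum_div]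

theorem sliceExp_mono {n s : ℕ} {f g : Finset (Fin n) → ℝ}
    (h : ∀ T, T.card = s → f T ≤ g T) : sliceExp n s f ≤ sliceExp n s g := by
  unfold sliceExp
  gcongr with T hT
  exact h T (mem_powersetCard.1 hT).2

theorem sliceExp_congr {n s : ℕ} {f g : Finset (Fin n) → ℝ}
    (h : ∀ T, T.card = s → f T = g T) : sliceExp n s f = sliceExp n s g :=
  le_antisymm (sliceExp_mono fun T hT => (h T hT).le) (sliceExp_mono fun T hT => (h T hT).ge)

theorem sliceExp_const {n s : ℕ} (hs : s ≤ n) (c : ℝ) : sliceExp n s (fun _ => c) = c := by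
  have h : ((powersetCard s (univ : Finset (Fin n))).card : ℝ) ≠ 0 := by
    rw [card_powersetCard, card_univ, Fintype.card_fin]
    exact_mod_cast (Nat.choose_pos hs).ne'
  simp only [sliceExp, sum_const, nsmul_eq_mul]
  field_simp

theorem abs_sliceExp_le {n s : ℕ} (f : Finset (Fin n) → ℝ) :
    |sliceExp n s f| ≤ sliceExp n s (fun T => |f T|) := by
  unfold sliceExp
  rw [abs_div, Nat.abs_cast]
  gcongr
  exact abs_sum_le_sum_abs _ _

theorem sliceExp_map {n s : ℕ} (e : Equiv.Perm (Fin n)) (f : Finset (Fin n) → ℝ) :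
    sliceExp n s (fun T => f (T.map e.toEmbedding)) = sliceExp n s f := by
  unfold sliceExp
  congr 1
  refine sum_equiv (Equiv.finsetCongr e) ?_ ?_
  · intro T
    simp [mem_powersetCard]
  · intro T _
    rfl

/-- The change of the linear form with coefficients `b` when the coordinates `i` and `j` of the
indicator vector of `T` are exchanged. -/
noncomputable def swapDiff {n : ℕ} (b : Fin n → ℝ) (i j : Fin n) (T : Finset (Fin n)) : ℝ :=
  (b i - b j) * ((if i ∈ T then 1 else 0) - (if j ∈ T then 1 else 0))

theorem sum_map_swap {n : ℕ} (b : Fin n → ℝ) (i j : Fin n) (T : Finset (Fin n)) :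
    ∑ k ∈ T.map (Equiv.swap i j).toEmbedding, b k = ∑ k ∈ T, b k - swapDiff b i j T := by
  rw [sum_map]
  have h : ∀ k, b (Equiv.swap i j k) =
      b k - ((if k = i then b i - b j else 0) - (if k = j then b i - b j else 0)) := by
    intro k
    rw [Equiv.swap_apply_def]
    split_ifs <;> simp_all
  simp only [Equiv.coe_toEmbedding, h, sum_sub_distrib, sum_ite_eq', swapDiff]
  split_ifs <;> ring

theorem swapDiff_map_swap {n : ℕ} (b : Fin n → ℝ) (i j : Fin n) (T : Finset (Fin n)) :
    swapDiff b i j (T.map (Equiv.swap i j).toEmbedding) = -swapDiff b i j T := by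
  have hi : i ∈ T.map (Equiv.swap i j).toEmbedding ↔ j ∈ T := by
    simp [mem_map_equiv]
  have hj : j ∈ T.map (Equiv.swap i j).toEmbedding ↔ i ∈ T := by
    simp [mem_map_equiv]
  simp only [swapDiff, hi, hj]
  ring

theorem sum_eq_sum_mul_indicator {n : ℕ} (b : Fin n → ℝ) (T : Finset (Fin n)) :
    ∑ i ∈ T, b i = ∑ i, b i * (if i ∈ T then 1 else 0) := by
  simp

theorem sum_swapDiff {n : ℕ} {b : Fin n → ℝ} (hb : ∑ i, b i = 0) (T : Finset (Fin n)) :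
    ∑ i, ∑ j, swapDiff b i j T = 2 * n * ∑ i ∈ T, b i := by
  rw [sum_eq_sum_mul_indicator b T]
  set x : Fin n → ℝ := fun i => if i ∈ T then 1 else 0 with hx
  obtain ⟨u, hu⟩ : ∃ u : Fin n → ℝ, ∀ i, u i = b i * x i := ⟨_, fun _ => rfl⟩
  change _ = 2 * n * ∑ i, b i * x i
  have h : ∀ i j, swapDiff b i j T = u i - b i * x j - x i * b j + u j :=
    fun i j => by simp only [swapDiff, hu, hx]; ring
  simp only [h, ← hu, sum_add_distrib, sum_sub_distrib, ← mul_sum, ← sum_mul, hb, sum_const, card_univ,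
    Fintype.card_fin, nsmul_eq_mul]
  ring

/-- Exchangeable-pair identity for a centred linear form on the slice. -/
theorem sliceExp_sum_mul {n s : ℕ} {b : Fin n → ℝ} (hb : ∑ i, b i = 0)
    (G : Finset (Fin n) → ℝ) :
    4 * n * sliceExp n s (fun T => (∑ i ∈ T, b i) * G T) =
      sliceExp n s (fun T => ∑ i, ∑ j,
        swapDiff b i j T * (G T - G (T.map (Equiv.swap i j).toEmbedding))) := by
  have h : ∀ i j, sliceExp n s
      (fun T => swapDiff b i j T * (G T - G (T.map (Equiv.swap i j).toEmbedding))) =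
        sliceExp n s (fun T => 2 * (swapDiff b i j T * G T)) := by
    intro i j
    have h1 := sliceExp_map (s := s) (Equiv.swap i j) (fun T => swapDiff b i j T * G T)
    simp only [swapDiff_map_swap] at h1
    have h2 : sliceExp n s (fun T => -1 *
        (swapDiff b i j T * G (T.map (Equiv.swap i j).toEmbedding))) =
          sliceExp n s (fun T => swapDiff b i j T * G T) := by
      rw [← h1]; exact sliceExp_congr fun T _ => by ring
    rw [sliceExp_const_mul] at h2
    simp only [mul_sub]
    rw [sliceExp_sub, sliceExp_const_mul]
    linarith
  rw [sliceExp_sum]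
  simp only [sliceExp_sum, h]
  simp only [← sliceExp_sum]
  rw [← sliceExp_const_mul]
  refine sliceExp_congr fun T _ => ?_
  simp only [← mul_sum, ← sum_mul]
  rw [sum_swapDiff hb]
  ring

/-- The conditional mean square of a random swap, suitably normalised. -/
noncomputable def swapVar {n : ℕ} (b : Fin n → ℝ) (T : Finset (Fin n)) : ℝ :=
  (∑ i, ∑ j, swapDiff b i j T ^ 2) / (4 * n)

theorem swapVar_nonneg {n : ℕ} (b : Fin n → ℝ) (T : Finset (Fin n)) : 0 ≤ swapVar b T := by
  unfold swapVar
  positivity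

theorem swapDiff_sq_le {n : ℕ} (b : Fin n → ℝ) (i j : Fin n) (T : Finset (Fin n)) :
    swapDiff b i j T ^ 2 ≤ (b i - b j) ^ 2 := by
  unfold swapDiff
  split_ifs <;> simp [sq_nonneg, sub_sq_comm]

theorem abs_swapDiff_le {n : ℕ} (b : Fin n → ℝ) (i j : Fin n) (T : Finset (Fin n)) :
    |swapDiff b i j T| ≤ |b i - b j| :=
  sq_le_sq.1 (swapDiff_sq_le b i j T)

theorem swapVar_le {n : ℕ} (hn : 0 < n) {b : Fin n → ℝ} (hb : ∑ i, b i = 0)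
    (T : Finset (Fin n)) : swapVar b T ≤ (∑ i, b i ^ 2) / 2 := by
  have hn' : (0 : ℝ) < n := by exact_mod_cast hn
  have h : ∑ i, ∑ j, (b i - b j) ^ 2 = 2 * n * ∑ i, b i ^ 2 := by
    have h' : ∀ i j, (b i - b j) ^ 2 = b i ^ 2 - 2 * b i * b j + b j ^ 2 := fun i j => by ring
    simp only [h', sum_add_distrib, sum_sub_distrib, ← mul_sum, hb, sum_const, card_univ,
      Fintype.card_fin, nsmul_eq_mul, mul_zero]
    ring
  rw [swapVar, div_le_iff₀ (by positivity)]
  calc _ ≤ ∑ i, ∑ j, (b i - b j) ^ 2 :=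
        sum_le_sum fun i _ => sum_le_sum fun j _ => swapDiff_sq_le b i j T
    _ = _ := by rw [h]; ring

theorem swapVar_eq {n s : ℕ} (hn : 0 < n) {b : Fin n → ℝ} (hb : ∑ i, b i = 0)
    {T : Finset (Fin n)} (hT : T.card = s) :
    swapVar b T = ((n - 2 * s) * ∑ i ∈ T, b i ^ 2 + s * ∑ i, b i ^ 2) / (2 * n) +
      (∑ i ∈ T, b i) ^ 2 / n := by
  have hn' : (0 : ℝ) < n := by exact_mod_cast hn
  rw [sum_eq_sum_mul_indicator (fun i => b i ^ 2), sum_eq_sum_mul_indicator b]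
  set x : Fin n → ℝ := fun i => if i ∈ T then 1 else 0 with hx
  have hxs : ∑ i, x i = s := by simp [hx, hT]
  have hxx : ∀ i, x i ^ 2 = x i := fun i => by simp [hx]
  obtain ⟨u, hu⟩ : ∃ u : Fin n → ℝ, ∀ i, u i = b i * x i := ⟨_, fun _ => rfl⟩
  obtain ⟨w, hw⟩ : ∃ w : Fin n → ℝ, ∀ i, w i = b i ^ 2 * x i := ⟨_, fun _ => rfl⟩
  have h : ∀ i j, swapDiff b i j T ^ 2 = w i + b i ^ 2 * x j - 2 * w i * x j
      - 2 * u i * b j - 2 * b i * u j + 4 * u i * u j + x i * b j ^ 2 + w j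
      - 2 * x i * w j := by
    intro i j
    have : swapDiff b i j T ^ 2 =
        (b i - b j) ^ 2 * (x i ^ 2 - 2 * x i * x j + x j ^ 2) := by
      simp only [swapDiff, hx]; ring
    rw [this, hxx, hxx, hu, hu, hw, hw]
    ring
  have h2 : ∑ i, ∑ j, swapDiff b i j T ^ 2 = 2 * (n - 2 * s) * ∑ i, b i ^ 2 * x i +
      2 * s * ∑ i, b i ^ 2 + 4 * (∑ i, b i * x i) ^ 2 := by
    simp only [h, ← hu, ← hw, sum_add_distrib, sum_sub_distrib, ← mul_sum, ← sum_mul, hb, hxs, sum_const,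
      card_univ, Fintype.card_fin, nsmul_eq_mul]
    ring
  rw [swapVar, h2]
  field_simp
  ring

theorem sliceExp_sum_eq_zero {n s : ℕ} (hn : 0 < n) {b : Fin n → ℝ} (hb : ∑ i, b i = 0) :
    sliceExp n s (fun T => ∑ i ∈ T, b i) = 0 := by
  have hn' : (0 : ℝ) < n := by exact_mod_cast hn
  have h := sliceExp_sum_mul (s := s) hb (fun _ => 1)
  simp only [mul_one, sub_self, mul_zero, sum_const_zero] at h
  have h0 : sliceExp n s (fun _ => 0) = 0 := by simp [sliceExp]
  rw [h0] at h
  have : (4 * n : ℝ) ≠ 0 := by positivity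
  exact (mul_eq_zero.1 h).resolve_left this

theorem sliceExp_sum_sq {n s : ℕ} (hn : 0 < n) {b : Fin n → ℝ} (hb : ∑ i, b i = 0) :
    sliceExp n s (fun T => (∑ i ∈ T, b i) ^ 2) = sliceExp n s (swapVar b) := by
  have hn' : (0 : ℝ) < n := by exact_mod_cast hn
  have h := sliceExp_sum_mul (s := s) hb (fun T => ∑ i ∈ T, b i)
  simp only [sum_map_swap, sub_sub_cancel, ← pow_two] at h
  have h1 : sliceExp n s (fun T => ∑ i, ∑ j, swapDiff b i j T ^ 2) =
      4 * n * sliceExp n s (swapVar b) := by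
    rw [← sliceExp_const_mul]
    refine sliceExp_congr fun T _ => ?_
    unfold swapVar
    field_simp
  rw [h1] at h
  exact mul_left_cancel₀ (by positivity) h

theorem sliceExp_sum_sq_le {n s : ℕ} (hn : 0 < n) (hs : s ≤ n) {b : Fin n → ℝ}
    (hb : ∑ i, b i = 0) :
    sliceExp n s (fun T => (∑ i ∈ T, b i) ^ 2) ≤ (∑ i, b i ^ 2) / 2 := by
  rw [sliceExp_sum_sq hn hb, ← sliceExp_const hs ((∑ i, b i ^ 2) / 2)]
  exact sliceExp_mono fun T _ => swapVar_le hn hb T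

/-- The moment generating function of the linear form with coefficients `b` on the slice. -/
noncomputable def sliceMgf {n : ℕ} (s : ℕ) (b : Fin n → ℝ) (t : ℝ) : ℝ :=
  sliceExp n s (fun T => Real.exp (t * ∑ i ∈ T, b i))

theorem hasDerivAt_sliceMgf {n : ℕ} (s : ℕ) (b : Fin n → ℝ) (t : ℝ) :
    HasDerivAt (sliceMgf s b)
      (sliceExp n s (fun T => (∑ i ∈ T, b i) * Real.exp (t * ∑ i ∈ T, b i))) t := by
  unfold sliceMgf sliceExp
  refine HasDerivAt.div_const (HasDerivAt.fun_sum fun T _ => ?_) _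
  have := ((hasDerivAt_id t).mul_const (∑ i ∈ T, b i)).exp
  simpa [mul_comm] using this

theorem one_le_sliceMgf {n s : ℕ} (hn : 0 < n) (hs : s ≤ n) {b : Fin n → ℝ}
    (hb : ∑ i, b i = 0) (t : ℝ) : 1 ≤ sliceMgf s b t := by
  calc 1 = sliceExp n s (fun T => t * (∑ i ∈ T, b i) + 1) := by
        rw [sliceExp_add, sliceExp_const_mul, sliceExp_sum_eq_zero hn hb, sliceExp_const hs]
        ring
    _ ≤ _ := sliceExp_mono fun T _ => Real.add_one_le_exp _

theorem abs_deriv_sliceMgf_sub_le {n s : ℕ} (hn : 0 < n) {b : Fin n → ℝ} (hb : ∑ i, b i = 0)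
    {B t : ℝ} (hB : ∀ i j, |b i - b j| ≤ B) (ht : |t| * B ≤ 1) :
    |sliceExp n s (fun T => (∑ i ∈ T, b i) * Real.exp (t * ∑ i ∈ T, b i)) -
      t * sliceExp n s (fun T => swapVar b T * Real.exp (t * ∑ i ∈ T, b i))| ≤
      t ^ 2 * B * sliceExp n s (fun T => swapVar b T * Real.exp (t * ∑ i ∈ T, b i)) := by
  have hn' : (0 : ℝ) < n := by exact_mod_cast hn
  have h4 : (0 : ℝ) < 4 * n := by positivity
  have hW : ∀ T, ∑ i, ∑ j, swapDiff b i j T ^ 2 = 4 * n * swapVar b T := fun T => by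
    unfold swapVar; field_simp
  refine le_of_mul_le_mul_left ?_ h4
  rw [← abs_of_pos h4, ← abs_mul, abs_of_pos h4, mul_sub, sliceExp_sum_mul hb,
    ← mul_assoc, ← mul_assoc, ← sliceExp_const_mul, ← sliceExp_const_mul, ← sliceExp_sub]
  refine (abs_sliceExp_le _).trans (sliceExp_mono fun T _ => ?_)
  simp only [sum_map_swap]
  set y := ∑ i ∈ T, b i
  have e1 : 4 * n * t * (swapVar b T * Real.exp (t * y)) =
      ∑ i, ∑ j, t * swapDiff b i j T ^ 2 * Real.exp (t * y) := by
    simp only [← mul_sum, ← sum_mul, hW]; ring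
  have e2 : 4 * n * (t ^ 2 * B) * (swapVar b T * Real.exp (t * y)) =
      ∑ i, ∑ j, t ^ 2 * B * swapDiff b i j T ^ 2 * Real.exp (t * y) := by
    simp only [← mul_sum, ← sum_mul, hW]; ring
  rw [e1, e2, ← sum_sub_distrib]
  refine (abs_sum_le_sum_abs _ _).trans (sum_le_sum fun i _ => ?_)
  rw [← sum_sub_distrib]
  refine (abs_sum_le_sum_abs _ _).trans (sum_le_sum fun j _ => ?_)
  set d := swapDiff b i j T
  have hd : |d| ≤ B := (abs_swapDiff_le b i j T).trans (hB i j)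
  have hB0 : 0 ≤ B := (abs_nonneg _).trans hd
  have htd : |-(t * d)| ≤ 1 := by
    rw [abs_neg, abs_mul]
    exact (mul_le_mul_of_nonneg_left hd (abs_nonneg _)).trans ht
  have h1 := Real.abs_exp_sub_one_sub_id_le htd
  have e3 : d * (Real.exp (t * y) - Real.exp (t * (y - d))) - t * d ^ 2 * Real.exp (t * y) =
      -(d * (Real.exp (-(t * d)) - 1 - -(t * d))) * Real.exp (t * y) := by
    rw [show t * (y - d) = t * y + -(t * d) by ring, Real.exp_add]
    ring
  rw [e3, abs_mul, abs_neg, abs_mul, Real.abs_exp]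
  refine mul_le_mul_of_nonneg_right ?_ (Real.exp_pos _).le
  calc _ ≤ B * (-(t * d)) ^ 2 := mul_le_mul hd h1 (abs_nonneg _) hB0
    _ = _ := by ring

theorem sliceExp_swapVar_mul_exp_le {n s : ℕ} (hn : 0 < n) {b : Fin n → ℝ}
    (hb : ∑ i, b i = 0) (t : ℝ) :
    sliceExp n s (fun T => swapVar b T * Real.exp (t * ∑ i ∈ T, b i)) ≤
      (∑ i, b i ^ 2) / 2 * sliceMgf s b t := by
  rw [sliceMgf, ← sliceExp_const_mul]
  exact sliceExp_mono fun T _ =>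
    mul_le_mul_of_nonneg_right (swapVar_le hn hb T) (Real.exp_pos _).le

theorem sliceExp_swapVar_mul_exp_nonneg {n s : ℕ} (b : Fin n → ℝ) (t : ℝ) :
    0 ≤ sliceExp n s (fun T => swapVar b T * Real.exp (t * ∑ i ∈ T, b i)) := by
  unfold sliceExp
  have := fun T => swapVar_nonneg b T
  exact div_nonneg (sum_nonneg fun T _ => mul_nonneg (this T) (Real.exp_pos _).le)
    (Nat.cast_nonneg _)

/-- Crude subgaussian bound for the moment generating function. -/
theorem sliceMgf_le {n s : ℕ} (hn : 0 < n) (hs : s ≤ n) {b : Fin n → ℝ} (hb : ∑ i, b i = 0)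
    {B : ℝ} (hB : ∀ i j, |b i - b j| ≤ B) (hB2 : 2 * B ≤ 1) {t : ℝ} (ht : |t| ≤ 2) :
    sliceMgf s b t ≤ Real.exp (4 * ∑ i, b i ^ 2) := by
  have hB0 : 0 ≤ B := (abs_nonneg _).trans (hB ⟨0, hn⟩ ⟨0, hn⟩)
  have hM : ∀ u, 0 < sliceMgf s b u := fun u => one_pos.trans_le (one_le_sliceMgf hn hs hb u)
  have hη : 0 ≤ ∑ i, b i ^ 2 := sum_nonneg fun i _ => sq_nonneg _
  have hd : ∀ u ∈ Set.Icc (-2 : ℝ) 2, HasDerivWithinAt (fun u => Real.log (sliceMgf s b u))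
      (sliceExp n s (fun T => (∑ i ∈ T, b i) * Real.exp (u * ∑ i ∈ T, b i)) / sliceMgf s b u)
      (Set.Icc (-2 : ℝ) 2) u := fun u _ =>
    ((hasDerivAt_sliceMgf s b u).log (hM u).ne').hasDerivWithinAt
  have hbound : ∀ u ∈ Set.Icc (-2 : ℝ) 2,
      ‖sliceExp n s (fun T => (∑ i ∈ T, b i) * Real.exp (u * ∑ i ∈ T, b i)) /
        sliceMgf s b u‖ ≤ 2 * ∑ i, b i ^ 2 := by
    intro u hu
    have hu2 : |u| ≤ 2 := abs_le.2 hu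
    have huB : |u| * B ≤ 1 := (mul_le_mul_of_nonneg_right hu2 hB0).trans hB2
    have h1 := abs_deriv_sliceMgf_sub_le (s := s) hn hb hB huB
    have h2 := sliceExp_swapVar_mul_exp_le (s := s) hn hb u
    have h3 := sliceExp_swapVar_mul_exp_nonneg (s := s) b u
    rw [Real.norm_eq_abs, abs_div, abs_of_pos (hM u), div_le_iff₀ (hM u)]
    set w := sliceExp n s (fun T => swapVar b T * Real.exp (u * ∑ i ∈ T, b i))
    set d := sliceExp n s (fun T => (∑ i ∈ T, b i) * Real.exp (u * ∑ i ∈ T, b i))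
    have h4 : |u * w| ≤ 2 * w := by
      rw [abs_mul, abs_of_nonneg h3]; exact mul_le_mul_of_nonneg_right hu2 h3
    have h5 : u ^ 2 * B ≤ 2 := by
      rw [← sq_abs]; nlinarith [abs_nonneg u]
    have h6 : u ^ 2 * B * w ≤ 2 * w := mul_le_mul_of_nonneg_right h5 h3
    have h7 : |d| ≤ |d - u * w| + |u * w| := by
      simpa using abs_add_le (d - u * w) (u * w)
    linarith
  have h0 : sliceMgf s b 0 = 1 := by simp [sliceMgf, sliceExp_const hs]
  have key := (convex_Icc (-2 : ℝ) 2).norm_image_sub_le_of_norm_hasDerivWithin_le hd hbound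
    (x := 0) (y := t) (by constructor <;> norm_num) (abs_le.1 ht)
  simp only [h0, Real.log_one, sub_zero, Real.norm_eq_abs] at key
  rw [← Real.log_le_iff_le_exp (hM t)]
  have := mul_le_mul_of_nonneg_left ht (show 0 ≤ 2 * ∑ i, b i ^ 2 by positivity)
  linarith [le_abs_self (Real.log (sliceMgf s b t))]

theorem sq_le_exp_add_exp_neg (y : ℝ) : y ^ 2 ≤ Real.exp y + Real.exp (-y) := by
  have h1 : Real.exp y + Real.exp (-y) = 2 + 4 * Real.sinh (y / 2) ^ 2 := by
    have h2 := Real.cosh_two_mul (y / 2)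
    have h3 := Real.cosh_sq (y / 2)
    rw [mul_div_cancel₀ _ two_ne_zero, Real.cosh_eq] at h2
    linarith
  have h4 : (y / 2) ^ 2 ≤ Real.sinh (y / 2) ^ 2 := by
    rcases le_total 0 (y / 2) with h | h
    · exact pow_le_pow_left₀ h (Real.self_le_sinh_iff.2 h) 2
    · have := Real.sinh_le_self_iff.2 h
      nlinarith
  rw [h1]
  linarith

/-- The swap variance is nearly constant, also after exponential tilting. -/
theorem abs_sliceExp_swapVar_sub_le {n s : ℕ} (hn : 0 < n) (hs : s ≤ n) {b : Fin n → ℝ}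
    (hb : ∑ i, b i = 0) {B K : ℝ} (hb' : ∀ i, |b i| ≤ B) (hK : ∀ t, |t| ≤ 2 → sliceMgf s b t ≤ K)
    {c : ℝ} (hc : 0 < c) {t : ℝ} (ht : |t| ≤ 1) :
    |sliceExp n s (fun T => swapVar b T * Real.exp (t * ∑ i ∈ T, b i)) -
      sliceExp n s (swapVar b) * sliceMgf s b t| ≤
      c * (B ^ 2 * ∑ i, b i ^ 2) + K / c + 2 * K / n + (∑ i, b i ^ 2) * K / n := by
  have hn' : (0 : ℝ) < n := by exact_mod_cast hn
  have hsn : (s : ℝ) ≤ n := by exact_mod_cast hs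
  set η := ∑ i, b i ^ 2 with hη_def
  have hη : 0 ≤ η := sum_nonneg fun i _ => sq_nonneg _
  set v := sliceExp n s (swapVar b) with hv_def
  set q : Fin n → ℝ := fun i => b i ^ 2 - η / n with hq
  have hq0 : ∑ i, q i = 0 := by
    simp only [hq, sum_sub_distrib, sum_const, card_univ, Fintype.card_fin, nsmul_eq_mul]
    field_simp
    rw [hη_def]; ring
  have hqT : ∀ T : Finset (Fin n), T.card = s →
      ∑ i ∈ T, q i = ∑ i ∈ T, b i ^ 2 - s * η / n := by
    intro T hT
    simp only [hq, sum_sub_distrib, sum_const, hT, nsmul_eq_mul]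
    ring
  have hq2 : ∑ i, q i ^ 2 ≤ B ^ 2 * η := by
    have e : ∑ i, q i ^ 2 = ∑ i, (b i ^ 2) ^ 2 - η ^ 2 / n := by
      have : ∀ i, q i ^ 2 = (b i ^ 2) ^ 2 - 2 * (η / n) * b i ^ 2 + (η / n) ^ 2 := fun i => by
        simp only [hq]; ring
      simp only [this, sum_add_distrib, sum_sub_distrib, ← mul_sum, sum_const, card_univ,
        Fintype.card_fin, nsmul_eq_mul, ← hη_def]
      field_simp
      ring
    have h1 : ∑ i, (b i ^ 2) ^ 2 ≤ B ^ 2 * η := by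
      rw [hη_def, mul_sum]
      refine sum_le_sum fun i _ => ?_
      rw [pow_two (b i ^ 2)]
      have : b i ^ 2 ≤ B ^ 2 := by
        rw [← sq_abs]; exact pow_le_pow_left₀ (abs_nonneg _) (hb' i) 2
      exact mul_le_mul_of_nonneg_right this (sq_nonneg _)
    rw [e]
    have : 0 ≤ η ^ 2 / n := by positivity
    linarith
  have hvY : sliceExp n s (fun T => (∑ i ∈ T, b i) ^ 2) = v := sliceExp_sum_sq hn hb
  have hv_le : v ≤ η / 2 := hvY ▸ sliceExp_sum_sq_le hn hs hb
  have hv0 : 0 ≤ v := by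
    rw [← sliceExp_const hs (0 : ℝ)]
    exact sliceExp_mono fun T _ => swapVar_nonneg b T
  have hdecomp : ∀ T : Finset (Fin n), T.card = s →
      swapVar b T = (n - 2 * s) / (2 * n) * (∑ i ∈ T, q i) +
        (n - s) * s * η / n ^ 2 + 1 / n * (∑ i ∈ T, b i) ^ 2 := by
    intro T hT
    rw [swapVar_eq hn hb hT, hqT T hT]
    field_simp
    ring
  have hmean : v = (n - s) * s * η / n ^ 2 + 1 / n * v := by
    have h1 : v = sliceExp n s (fun T => (n - 2 * s) / (2 * n) * (∑ i ∈ T, q i) +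
        (n - s) * s * η / n ^ 2 + 1 / n * (∑ i ∈ T, b i) ^ 2) := sliceExp_congr hdecomp
    rw [sliceExp_add, sliceExp_add, sliceExp_const_mul, sliceExp_const_mul, hvY,
      sliceExp_sum_eq_zero hn hq0, sliceExp_const hs] at h1
    linarith
  have hcoef : |((n : ℝ) - 2 * s) / (2 * n)| ≤ 1 := by
    rw [abs_div, abs_of_pos (by positivity : (0 : ℝ) < 2 * n), div_le_one (by positivity), abs_le]
    have : (0 : ℝ) ≤ s := Nat.cast_nonneg s
    constructor <;> linarith
  have hpt : ∀ T : Finset (Fin n), T.card = s →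
      |swapVar b T * Real.exp (t * ∑ i ∈ T, b i) - v * Real.exp (t * ∑ i ∈ T, b i)| ≤
        c * (∑ i ∈ T, q i) ^ 2 + 1 / c * Real.exp ((2 * t) * ∑ i ∈ T, b i) +
        1 / n * (Real.exp ((t + 1) * ∑ i ∈ T, b i) + Real.exp ((t - 1) * ∑ i ∈ T, b i)) +
        v / n * Real.exp (t * ∑ i ∈ T, b i) := by
    intro T hT
    have h1 : swapVar b T - v = (n - 2 * s) / (2 * n) * (∑ i ∈ T, q i) +
        1 / n * (∑ i ∈ T, b i) ^ 2 - v / n := by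
      rw [hdecomp T hT]; linear_combination -hmean
    set y := ∑ i ∈ T, b i
    set z := ∑ i ∈ T, q i
    set E := Real.exp (t * y) with hE
    have hE0 : 0 < E := Real.exp_pos _
    have h2 : |swapVar b T - v| ≤ |z| + 1 / n * y ^ 2 + v / n := by
      rw [h1]
      refine (abs_sub _ _).trans ?_
      rw [abs_of_nonneg (by positivity : 0 ≤ v / n)]
      gcongr
      refine (abs_add_le _ _).trans ?_
      rw [abs_of_nonneg (by positivity : 0 ≤ 1 / (n : ℝ) * y ^ 2), abs_mul]
      gcongr
      exact mul_le_of_le_one_left (abs_nonneg _) hcoef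
    have h3 : |z| * E ≤ c * z ^ 2 + 1 / c * E ^ 2 := by
      have e : c * (c * z ^ 2 + 1 / c * E ^ 2 - |z| * E) =
          (c * |z| - E / 2) ^ 2 + 3 / 4 * E ^ 2 := by
        rw [← sq_abs z]; field_simp; ring
      have : 0 ≤ c * (c * z ^ 2 + 1 / c * E ^ 2 - |z| * E) := by rw [e]; positivity
      have := nonneg_of_mul_nonneg_right this hc
      linarith
    have h4 : y ^ 2 ≤ Real.exp y + Real.exp (-y) := sq_le_exp_add_exp_neg y
    have e1 : Real.exp ((2 * t) * y) = E ^ 2 := by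
      rw [hE, ← Real.exp_nat_mul]; congr 1; push_cast; ring
    have e2 : Real.exp ((t + 1) * y) = E * Real.exp y := by
      rw [hE, ← Real.exp_add]; congr 1; ring
    have e3 : Real.exp ((t - 1) * y) = E * Real.exp (-y) := by
      rw [hE, ← Real.exp_add]; congr 1; ring
    rw [← sub_mul, abs_mul, abs_of_pos hE0, e1, e2, e3, ← mul_add]
    calc _ ≤ (|z| + 1 / n * y ^ 2 + v / n) * E := by gcongr
      _ = |z| * E + 1 / n * (E * y ^ 2) + v / n * E := by ring
      _ ≤ _ := by gcongr
  have ht' := abs_le.1 ht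
  have hKb : ∀ u, |u| ≤ 2 → sliceExp n s (fun T => Real.exp (u * ∑ i ∈ T, b i)) ≤ K := hK
  rw [sliceMgf, ← sliceExp_const_mul, ← sliceExp_sub]
  refine ((abs_sliceExp_le _).trans (sliceExp_mono hpt)).trans ?_
  rw [sliceExp_add, sliceExp_add, sliceExp_add, sliceExp_const_mul, sliceExp_const_mul,
    sliceExp_const_mul, sliceExp_const_mul, sliceExp_add]
  have k1 := hKb (2 * t) (by rw [abs_mul]; norm_num; exact ht)
  have k2 := hKb (t + 1) (by rw [abs_le]; constructor <;> linarith)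
  have k3 := hKb (t - 1) (by rw [abs_le]; constructor <;> linarith)
  have k4 := hKb t (by linarith)
  have hK0 : 0 ≤ K := zero_le_one.trans ((one_le_sliceMgf hn hs hb t).trans k4)
  have k5 : sliceExp n s (fun T => (∑ i ∈ T, q i) ^ 2) ≤ B ^ 2 * η := by
    have := sliceExp_sum_sq_le hn hs hq0
    have : 0 ≤ ∑ i, q i ^ 2 := sum_nonneg fun i _ => sq_nonneg _
    linarith
  have k6 : 0 ≤ sliceExp n s (fun T => Real.exp (t * ∑ i ∈ T, b i)) :=
    zero_le_one.trans (one_le_sliceMgf hn hs hb t)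
  calc _ ≤ c * (B ^ 2 * η) + 1 / c * K + 1 / n * (K + K) + η / n * K := by
        gcongr
        linarith
    _ = _ := by ring

/-- Quantitative Gaussian approximation of the cumulant generating function at `1`. -/
theorem abs_log_sliceMgf_sub_le {n s : ℕ} (hn : 0 < n) (hs : s ≤ n) {b : Fin n → ℝ}
    (hb : ∑ i, b i = 0) {B : ℝ} (hb' : ∀ i, |b i| ≤ B) (hB : ∀ i j, |b i - b j| ≤ B)
    (hB2 : 2 * B ≤ 1) {c : ℝ} (hc : 0 < c) :
    |Real.log (sliceMgf s b 1) - sliceExp n s (fun T => (∑ i ∈ T, b i) ^ 2) / 2| ≤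
      B * ((∑ i, b i ^ 2) / 2) + (c * (B ^ 2 * ∑ i, b i ^ 2) +
        Real.exp (4 * ∑ i, b i ^ 2) / c + 2 * Real.exp (4 * ∑ i, b i ^ 2) / n +
        (∑ i, b i ^ 2) * Real.exp (4 * ∑ i, b i ^ 2) / n) := by
  have hB0 : 0 ≤ B := (abs_nonneg _).trans (hb' ⟨0, hn⟩)
  have hM : ∀ u, 0 < sliceMgf s b u := fun u => one_pos.trans_le (one_le_sliceMgf hn hs hb u)
  rw [sliceExp_sum_sq hn hb]
  set η := ∑ i, b i ^ 2 with hη_def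
  have hη : 0 ≤ η := sum_nonneg fun i _ => sq_nonneg _
  set v := sliceExp n s (swapVar b)
  set R := c * (B ^ 2 * η) + Real.exp (4 * η) / c + 2 * Real.exp (4 * η) / n +
    η * Real.exp (4 * η) / n with hR_def
  have hR : 0 ≤ R := by positivity
  have hd : ∀ u ∈ Set.Icc (0 : ℝ) 1,
      HasDerivWithinAt (fun u => Real.log (sliceMgf s b u) - v / 2 * u ^ 2)
      (sliceExp n s (fun T => (∑ i ∈ T, b i) * Real.exp (u * ∑ i ∈ T, b i)) / sliceMgf s b u
        - v * u)
      (Set.Icc (0 : ℝ) 1) u := fun u _ => by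
    have h1 := (hasDerivAt_sliceMgf s b u).log (hM u).ne'
    have h2 := (hasDerivAt_pow 2 u).const_mul (v / 2)
    refine ((h1.sub h2).congr_deriv ?_).hasDerivWithinAt
    simp
    ring
  have hbound : ∀ u ∈ Set.Icc (0 : ℝ) 1,
      ‖sliceExp n s (fun T => (∑ i ∈ T, b i) * Real.exp (u * ∑ i ∈ T, b i)) /
        sliceMgf s b u - v * u‖ ≤ B * (η / 2) + R := by
    rintro u ⟨hu0, hu1⟩
    have hu : |u| ≤ 1 := by rwa [abs_of_nonneg hu0]
    have h1 := abs_deriv_sliceMgf_sub_le (s := s) (t := u) hn hb hB (by nlinarith)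
    have h2 := sliceExp_swapVar_mul_exp_le (s := s) hn hb u
    have h3 := sliceExp_swapVar_mul_exp_nonneg (s := s) b u
    have h4 := abs_sliceExp_swapVar_sub_le hn hs hb hb'
      (fun t ht => sliceMgf_le hn hs hb hB hB2 ht) hc hu
    have h5 := one_le_sliceMgf hn hs hb u
    rw [Real.norm_eq_abs, div_sub' (hM u).ne', abs_div, abs_of_pos (hM u), div_le_iff₀ (hM u)]
    set w := sliceExp n s (fun T => swapVar b T * Real.exp (u * ∑ i ∈ T, b i))
    set d := sliceExp n s (fun T => (∑ i ∈ T, b i) * Real.exp (u * ∑ i ∈ T, b i))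
    set m := sliceMgf s b u
    have h6 : u ^ 2 * B * w ≤ B * (η / 2 * m) := by
      have : u ^ 2 ≤ 1 := pow_le_one₀ hu0 hu1
      calc u ^ 2 * B * w ≤ 1 * B * w := by gcongr
        _ = B * w := by ring
        _ ≤ _ := by gcongr
    have h7 : |u * (w - v * m)| ≤ R := by
      rw [abs_mul]
      exact (mul_le_of_le_one_left (abs_nonneg _) hu).trans h4
    have h8 : |d - m * (v * u)| ≤ |d - u * w| + |u * (w - v * m)| := by
      have e : d - m * (v * u) = (d - u * w) + u * (w - v * m) := by ring
      rw [e]; exact abs_add_le _ _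
    have h9 : R ≤ R * m := le_mul_of_one_le_right hR h5
    linarith
  have h0 : sliceMgf s b 0 = 1 := by simp [sliceMgf, sliceExp_const hs]
  have key := (convex_Icc (0 : ℝ) 1).norm_image_sub_le_of_norm_hasDerivWithin_le hd hbound
    (x := 0) (y := 1) (by constructor <;> norm_num) (by constructor <;> norm_num)
  simpa [h0] using key

theorem eventually_log_bounds : ∀ᶠ n : ℕ in Filter.atTop,
    1 ≤ Real.log n ∧ Real.log n ^ 5 ≤ (n : ℝ) ^ (1 / 9 : ℝ) ∧
      Real.exp (4 * Real.sqrt (Real.log n)) ≤ (n : ℝ) ^ (1 / 9 : ℝ) ∧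
      4 ≤ (n : ℝ) ^ (1 / 9 : ℝ) := by
  refine tendsto_natCast_atTop_atTop.eventually (p := fun x : ℝ => 1 ≤ Real.log x ∧
    Real.log x ^ 5 ≤ x ^ (1 / 9 : ℝ) ∧
      Real.exp (4 * Real.sqrt (Real.log x)) ≤ x ^ (1 / 9 : ℝ) ∧ 4 ≤ x ^ (1 / 9 : ℝ)) ?_
  have h1 := (isLittleO_log_rpow_atTop (r := 1 / 45) (by norm_num)).bound one_pos
  filter_upwards [h1, Real.tendsto_log_atTop.eventually_ge_atTop (36 ^ 2),
    (tendsto_rpow_atTop (y := 1 / 9) (by norm_num)).eventually_ge_atTop 4,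
    Filter.eventually_gt_atTop 0] with x hx hL h4 hx0
  refine ⟨by linarith, ?_, ?_, h4⟩
  · rw [one_mul, Real.norm_of_nonneg (by linarith),
      Real.norm_of_nonneg (Real.rpow_nonneg hx0.le _)] at hx
    calc Real.log x ^ 5 ≤ (x ^ (1 / 45 : ℝ)) ^ 5 := pow_le_pow_left₀ (by linarith) hx 5
      _ = _ := by rw [← Real.rpow_natCast, ← Real.rpow_mul hx0.le]; norm_num
  · rw [Real.rpow_def_of_pos hx0]
    refine Real.exp_le_exp.2 ?_
    have h36 : 36 ≤ Real.sqrt (Real.log x) := Real.le_sqrt_of_sq_le hL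
    have := Real.sq_sqrt (show 0 ≤ Real.log x by linarith)
    nlinarith

theorem error_bound {x r L P E η : ℝ} (hr0 : 0 < r) (hr1 : r ≤ 1) (hrr : 1 / x = r ^ 2)
    (hL1 : 1 ≤ L) (hL5 : L ^ 5 ≤ P) (hP4 : 4 ≤ P) (hη0 : 0 ≤ η) (hηL : η ≤ L) (hE0 : 0 ≤ E)
    (hEP : E ≤ P) :
    2 * (r * L ^ 2) * (η / 2) + (r⁻¹ * ((2 * (r * L ^ 2)) ^ 2 * η) + E / r⁻¹ + 2 * E / x +
      η * E / x) ≤ 9 * (r * P ^ 2) := by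
  have hL3 : L ^ 3 ≤ P := (pow_le_pow_right₀ hL1 (by norm_num)).trans hL5
  have hLP : L ≤ P := (le_self_pow₀ hL1 (by norm_num)).trans hL5
  have hP0 : 0 < P := by linarith
  have t1 : 2 * (r * L ^ 2) * (η / 2) ≤ r * P := by
    calc _ = r * (L ^ 2 * η) := by ring
      _ ≤ r * (L ^ 2 * L) := by gcongr
      _ = r * L ^ 3 := by ring
      _ ≤ _ := by gcongr
  have t2 : r⁻¹ * ((2 * (r * L ^ 2)) ^ 2 * η) ≤ 4 * (r * P) := by
    calc _ = 4 * (r * (L ^ 4 * η)) := by field_simp; ring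
      _ ≤ 4 * (r * (L ^ 4 * L)) := by gcongr
      _ = 4 * (r * L ^ 5) := by ring
      _ ≤ _ := by gcongr
  have t3 : E / r⁻¹ ≤ r * P := by
    rw [div_inv_eq_mul, mul_comm]
    gcongr
  have hrn : r ^ 2 ≤ r := pow_le_of_le_one hr0.le hr1 two_ne_zero
  have t4 : 2 * E / x ≤ 2 * (r * P) := by
    calc _ = 2 * (1 / x * E) := by ring
      _ ≤ _ := by rw [hrr]; gcongr
  have t5 : η * E / x ≤ r * P ^ 2 := by
    calc _ = 1 / x * (η * E) := by ring
      _ ≤ r * (P * P) := by rw [hrr]; gcongr; exact hηL.trans hLP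
      _ = _ := by ring
  have t6 : r * P ≤ r * P ^ 2 := by
    have : P ≤ P ^ 2 := le_self_pow₀ (by linarith) two_ne_zero
    gcongr
  linarith

/-- the exponential moment of a linear form on a slice of the hypercube:
under the stated conditions, `log E[e^X] = E[X] + Var[X]/2 ± C n^{-1/9}`. -/
theorem statement13 :
    ∃ C : ℝ, 0 < C ∧ ∃ n₀ : ℕ, ∀ n : ℕ, n₀ ≤ n → ∀ (a : Fin n → ℝ) (s : ℕ), s ≤ n →
      (n : ℝ) / (Real.log n) ^ 2 ≤ min (s : ℝ) ((n : ℝ) - s) →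
      (∀ i, |a i| ≤ (n : ℝ) ^ (-(1 : ℝ) / 2) * (Real.log n) ^ 2) →
      ((∑ i, (a i) ^ 2) - (∑ i, a i) ^ 2 / n ≤ Real.sqrt (Real.log n)) →
      |Real.log (sliceExp n s (fun T => Real.exp (∑ i ∈ T, a i))) -
          sliceExp n s (fun T => ∑ i ∈ T, a i) -
          (sliceExp n s (fun T =>
            ((∑ i ∈ T, a i) - sliceExp n s (fun T' => ∑ i ∈ T', a i)) ^ 2)) / 2| ≤
        C * (n : ℝ) ^ (-(1 : ℝ) / 9) := by
  obtain ⟨n₀, hn₀⟩ := Filter.eventually_atTop.1 eventually_log_bounds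
  refine ⟨9, by norm_num, max n₀ 1, fun n hn a s hs _ ha hη => ?_⟩
  obtain ⟨hL1, hL5, hE, hP4⟩ := hn₀ n (le_of_max_le_left hn)
  have hn1 : 0 < n := le_of_max_le_right hn
  have hn' : (0 : ℝ) < n := by exact_mod_cast hn1
  have hn1' : (1 : ℝ) ≤ n := by exact_mod_cast hn1
  set L := Real.log n
  set P := (n : ℝ) ^ (1 / 9 : ℝ) with hP
  set r := (n : ℝ) ^ (-(1 : ℝ) / 2) with hr
  have hr0 : 0 < r := Real.rpow_pos_of_pos hn' _
  have hr1 : r ≤ 1 := Real.rpow_le_one_of_one_le_of_nonpos hn1' (by norm_num)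
  have hrr : 1 / (n : ℝ) = r ^ 2 := by
    rw [hr, ← Real.rpow_natCast, ← Real.rpow_mul hn'.le, one_div, ← Real.rpow_neg_one]
    norm_num
  have hrP : r * P ^ 2 = (n : ℝ) ^ (-(5 : ℝ) / 18) := by
    rw [hr, hP, ← Real.rpow_natCast, ← Real.rpow_mul hn'.le, ← Real.rpow_add hn']
    norm_num
  have hrP1 : r * P ^ 2 ≤ 1 :=
    hrP ▸ Real.rpow_le_one_of_one_le_of_nonpos hn1' (by norm_num)
  have hrP9 : r * P ^ 2 ≤ (n : ℝ) ^ (-(1 : ℝ) / 9) :=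
    hrP ▸ Real.rpow_le_rpow_of_exponent_le hn1' (by norm_num)
  set m := (∑ i, a i) / n with hm
  set b : Fin n → ℝ := fun i => a i - m with hb_def
  have hb : ∑ i, b i = 0 := by
    simp only [hb_def, sum_sub_distrib, sum_const, card_univ, Fintype.card_fin, nsmul_eq_mul, hm]
    field_simp
    ring
  have hb2 : ∑ i, b i ^ 2 = ∑ i, a i ^ 2 - (∑ i, a i) ^ 2 / n := by
    have : ∀ i, b i ^ 2 = a i ^ 2 - 2 * m * a i + m ^ 2 := fun i => by simp only [hb_def]; ring
    simp only [this, sum_add_distrib, sum_sub_distrib, ← mul_sum, sum_const, card_univ,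
      Fintype.card_fin, nsmul_eq_mul, hm]
    field_simp
    ring
  have hm_le : |m| ≤ r * L ^ 2 := by
    rw [hm, abs_div, abs_of_pos hn', div_le_iff₀ hn']
    calc _ ≤ ∑ i, |a i| := abs_sum_le_sum_abs _ _
      _ ≤ ∑ _i : Fin n, r * L ^ 2 := sum_le_sum fun i _ => ha i
      _ = _ := by simp [mul_comm]
  have hbB : ∀ i, |b i| ≤ 2 * (r * L ^ 2) := fun i => by
    have := abs_sub (a i) m
    have := ha i
    simp only [hb_def]
    linarith
  have hbBB : ∀ i j, |b i - b j| ≤ 2 * (r * L ^ 2) := fun i j => by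
    have h1 : b i - b j = a i - a j := by simp only [hb_def]; ring
    have := abs_sub (a i) (a j)
    have := ha i
    have := ha j
    rw [h1]
    linarith
  have hL2 : L ^ 2 ≤ P := (pow_le_pow_right₀ hL1 (by norm_num)).trans hL5
  have hB2 : 2 * (2 * (r * L ^ 2)) ≤ 1 := by
    calc 2 * (2 * (r * L ^ 2)) = r * (4 * L ^ 2) := by ring
      _ ≤ r * (P * P) := by gcongr
      _ = r * P ^ 2 := by ring
      _ ≤ 1 := hrP1
  have key := abs_log_sliceMgf_sub_le hn1 hs hb hbB hbBB hB2 (inv_pos.2 hr0)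
  rw [← hb2] at hη
  have hsum : ∀ T : Finset (Fin n), T.card = s → ∑ i ∈ T, a i = ∑ i ∈ T, b i + s * m := by
    intro T hT
    simp [hb_def, sum_sub_distrib, hT]
  have hE1 : sliceExp n s (fun T => ∑ i ∈ T, a i) = s * m := by
    rw [sliceExp_congr hsum, sliceExp_add, sliceExp_sum_eq_zero hn1 hb, sliceExp_const hs,
      zero_add]
  have hE2 : sliceExp n s (fun T => (∑ i ∈ T, a i - s * m) ^ 2) =
      sliceExp n s (fun T => (∑ i ∈ T, b i) ^ 2) :=
    sliceExp_congr fun T hT => by rw [hsum T hT]; ring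
  have hE3 : sliceExp n s (fun T => Real.exp (∑ i ∈ T, a i)) =
      Real.exp (s * m) * sliceMgf s b 1 := by
    rw [sliceMgf, ← sliceExp_const_mul]
    exact sliceExp_congr fun T hT => by rw [hsum T hT, ← Real.exp_add]; congr 1; ring
  have hM1 := one_le_sliceMgf hn1 hs hb 1
  rw [hE1, hE2, hE3, Real.log_mul (Real.exp_pos _).ne' (by linarith), Real.log_exp,
    add_sub_cancel_left]
  refine key.trans ?_
  set η := ∑ i, b i ^ 2
  have hη0 : 0 ≤ η := sum_nonneg fun i _ => sq_nonneg _
  have hηL : η ≤ L := hη.trans (Real.sqrt_le_iff.2 ⟨by linarith, by nlinarith⟩)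
  have hEP : Real.exp (4 * η) ≤ P := (Real.exp_le_exp.2 (by linarith)).trans hE
  exact (error_bound hr0 hr1 hrr hL1 hL5 hP4 hη0 hηL (Real.exp_pos _).le hEP).trans
    (mul_le_mul_of_nonneg_left hrP9 (by norm_num))
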